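/- arXiv:2601.11994 — 2 statements merged into one kernel-verified Lean document; each statement's English description precedes it below -/
import Mathlib

section
/- Let (g_n) be a sequence in SL(2,ℝ) and (v_n) a sequence in ℝ² such that g_n → g in SL(2,ℝ) and v_n − g_n v_n → v in ℝ², for some g ∈ SL(2,ℝ) and v ∈ ℝ². If the sequence (v_n) does not converge, then g is unipotent, i.e. (g − I)² = 0 (equivalently, 1 is the only eigenvalue of g). -/
open Matrix Filter Topology

/-- `SL2` is the special linear group `SL(2,ℝ)`. -/
abbrev SL2 : Type := Matrix.SpecialLinearGroup (Fin 2) ℝ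

/-- `M2` is the space of 2×2 real matrices. -/
abbrev M2 : Type := Matrix (Fin 2) (Fin 2) ℝ

noncomputable instance : TopologicalSpace SL2 :=
  TopologicalSpace.induced (fun g => (g : M2)) inferInstance

/-- Chabauty-sense convergence of a sequence of subsets of a topological space `X`:
(i) every point of the limit is a limit of a sequence of points of the `H n`;
(ii) every convergent sequence `x (k n) ∈ H (k n)` along a strictly increasing sequence
of indices has its limit in `L`. -/
def ChabautyTendsto {X : Type*} [TopologicalSpace X] (H : ℕ → Set X) (L : Set X) : Prop :=
  (∀ h ∈ L, ∃ u : ℕ → X, (∀ n, u n ∈ H n) ∧ Filter.Tendsto u Filter.atTop (nhds h)) ∧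
  (∀ k : ℕ → ℕ, StrictMono k → ∀ x : ℕ → X, (∀ n, x n ∈ H (k n)) →
    ∀ l : X, Filter.Tendsto x Filter.atTop (nhds l) → l ∈ L)

/-- Conjugate `x S x⁻¹` of a subset `S` of a group by a group element `x`. -/
def conjSet {X : Type*} [Group X] (x : X) (S : Set X) : Set X :=
  (fun s => x * s * x⁻¹) '' S

theorem tendsto_mulVec_aux (B : ℕ → M2) (w : ℕ → (Fin 2 → ℝ)) (B0 : M2) (w0 : Fin 2 → ℝ)
    (hB : Tendsto B atTop (𝓝 B0)) (hw : Tendsto w atTop (𝓝 w0)) :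
    Tendsto (fun k => B k *ᵥ w k) atTop (𝓝 (B0 *ᵥ w0)) := by
  have hc : Continuous (fun p : M2 × (Fin 2 → ℝ) => p.1 *ᵥ p.2) :=
    Continuous.matrix_mulVec continuous_fst continuous_snd
  have h2 : Tendsto (fun k => (B k, w k)) atTop (𝓝 (B0, w0)) := hB.prodMk_nhds hw
  have h1 := hc.tendsto (B0, w0)
  exact h1.comp h2

/-- If `gₙ → g` in `SL(2,ℝ)`, `vₙ - gₙ vₙ → v` in `ℝ²`, and `(vₙ)` does not
converge, then `g` is unipotent: `(g - I)² = 0`. -/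
theorem unipotent_of_nonconvergent (gseq : ℕ → SL2) (vseq : ℕ → (Fin 2 → ℝ))
    (g : SL2) (v : Fin 2 → ℝ)
    (hg : Tendsto gseq atTop (𝓝 g))
    (hv : Tendsto (fun k => vseq k - (gseq k : M2) *ᵥ vseq k) atTop (𝓝 v))
    (hnc : ¬ ∃ w : Fin 2 → ℝ, Tendsto vseq atTop (𝓝 w)) :
    ((g : M2) - 1) ^ 2 = 0 := by
  have hg' : Tendsto (fun k => (gseq k : M2)) atTop (𝓝 (g : M2)) :=
    (continuous_induced_dom.tendsto g).comp hg
  have hA : Tendsto (fun k => (1 : M2) - (gseq k : M2)) atTop (𝓝 (1 - (g : M2))) :=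
    tendsto_const_nhds.sub hg'
  by_cases hd : (1 - (g : M2)).det = 0
  · have h1 := g.det_coe
    rw [Matrix.det_fin_two] at h1 hd
    simp only [Matrix.sub_apply, Matrix.one_apply_eq] at hd
    have e01 : (1 : M2) 0 1 = 0 := by simp
    have e10 : (1 : M2) 1 0 = 0 := by simp
    rw [e01, e10] at hd
    have ht : (g : M2) 1 1 = 2 - (g : M2) 0 0 := by linarith
    rw [ht] at h1
    ext i j
    fin_cases i <;> fin_cases j <;>
      simp [pow_two, Matrix.mul_apply, Fin.sum_univ_two, ht] <;> linarith
  · exfalso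
    apply hnc
    have hdet : Tendsto (fun k => ((1 : M2) - (gseq k : M2)).det) atTop
        (𝓝 (1 - (g : M2)).det) :=
      ((continuous_id.matrix_det).tendsto (1 - (g : M2))).comp hA
    have hadj : Tendsto (fun k => ((1 : M2) - (gseq k : M2)).adjugate) atTop
        (𝓝 (1 - (g : M2)).adjugate) :=
      ((continuous_id.matrix_adjugate).tendsto (1 - (g : M2))).comp hA
    have hmul : Tendsto (fun k => ((1 : M2) - (gseq k : M2)).adjugate *ᵥ
        (vseq k - (gseq k : M2) *ᵥ vseq k)) atTop (𝓝 ((1 - (g : M2)).adjugate *ᵥ v)) :=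
      tendsto_mulVec_aux _ _ _ _ hadj hv
    refine ⟨_, ((hdet.inv₀ hd).smul hmul).congr' ?_⟩
    filter_upwards [hdet.eventually_ne hd] with k hk
    have : vseq k - (gseq k : M2) *ᵥ vseq k = ((1 : M2) - (gseq k : M2)) *ᵥ vseq k := by
      rw [Matrix.sub_mulVec, Matrix.one_mulVec]
    rw [this, Matrix.mulVec_mulVec, Matrix.adjugate_mul, Matrix.smul_mulVec,
      Matrix.one_mulVec, smul_smul, inv_mul_cancel₀ hk, one_smul]
end

section
/- Let K = SO(2,ℝ) = {(cos θ, sin θ; −sin θ, cos θ) : θ ∈ ℝ} ⊂ SL(2,ℝ) and Ñ⁺ = {±(1, s; 0, 1) : s ∈ ℝ} ⊂ SL(2,ℝ). Let g_n = 𝔰_n 𝔞_n, where 𝔰_n = (1, s_n; 0, 1) and 𝔞_n = diag(a_n, 1/a_n) with a_n > 0, and suppose s_n → ∞ or a_n → ∞. If g_n K g_n⁻¹ → H in the Chabauty sense for a closed subgroup H of SL(2,ℝ), then H = Ñ⁺. -/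
open Matrix Filter Topology

/-- The unipotent matrix `(1, s; 0, 1)` as an element of `SL(2,ℝ)`. -/
noncomputable def sMat (s : ℝ) : SL2 :=
  ⟨!![1, s; 0, 1], by simp [Matrix.det_fin_two_of]⟩

/-- The diagonal matrix `diag(a, 1/a)` as an element of `SL(2,ℝ)` (for `a ≠ 0`). -/
noncomputable def aMat (a : ℝ) (ha : a ≠ 0) : SL2 :=
  ⟨!![a, 0; 0, a⁻¹], by simp [Matrix.det_fin_two_of, mul_inv_cancel₀ ha]⟩

/-- `K = SO(2,ℝ)` as a subset of `SL(2,ℝ)`. -/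
def KSL : Set SL2 :=
  {g | ∃ θ : ℝ, (g : M2) = !![Real.cos θ, Real.sin θ; -Real.sin θ, Real.cos θ]}

/-- `Ñ⁺ = {±(1, s; 0, 1) : s ∈ ℝ}` as a subset of `SL(2,ℝ)`. -/
def NtildeSL : Set SL2 :=
  {g | ∃ s : ℝ, (g : M2) = !![1, s; 0, 1] ∨ (g : M2) = -!![1, s; 0, 1]}

lemma tendsto_SL2_iff (x : ℕ → SL2) (l : SL2) :
    Tendsto x atTop (𝓝 l) ↔ ∀ i j, Tendsto (fun n => (x n : M2) i j) atTop (𝓝 ((l : M2) i j)) := by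
  have h : Topology.IsInducing (fun g : SL2 => (g : M2)) := ⟨rfl⟩
  rw [h.tendsto_nhds_iff]
  constructor
  · intro h i j
    exact (tendsto_pi_nhds.1 (tendsto_pi_nhds.1 h i)) j
  · intro h
    exact tendsto_pi_nhds.2 fun i => tendsto_pi_nhds.2 fun j => h i j

lemma conj_entries (s a : ℝ) (ha : 0 < a) (k : SL2) (c σ : ℝ)
    (hk : (k : M2) = !![c, σ; -σ, c]) :
    ((sMat s * aMat a ha.ne' * k * (sMat s * aMat a ha.ne')⁻¹ : SL2) : M2) =
      !![c - s * (σ / a ^ 2), (a ^ 4 + s ^ 2) * (σ / a ^ 2); -(σ / a ^ 2), c + s * (σ / a ^ 2)] := by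
  have h0 := ha.ne'
  have e : ((sMat s * aMat a ha.ne' * k * (sMat s * aMat a ha.ne')⁻¹ : SL2) : M2) =
      !![1, s; 0, 1] * !![a, 0; 0, a⁻¹] * !![c, σ; -σ, c] *
        Matrix.adjugate (!![1, s; 0, 1] * !![a, 0; 0, a⁻¹]) := by
    rw [← hk]; rfl
  rw [e, Matrix.adjugate_fin_two]
  ext i j
  fin_cases i <;> fin_cases j <;>
    simp [Matrix.mul_apply, Fin.sum_univ_two] <;> field_simp <;> try ring

lemma D_tendsto (s a : ℕ → ℝ)
    (hdiv : Tendsto s atTop atTop ∨ Tendsto a atTop atTop) :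
    Tendsto (fun n => a n ^ 4 + s n ^ 2) atTop atTop := by
  rcases hdiv with h | h
  · exact tendsto_atTop_mono (fun n => by
      simp only [Function.comp]; nlinarith [sq_nonneg (a n ^ 2)])
      ((tendsto_pow_atTop (n := 2) (by norm_num)).comp h)
  · exact tendsto_atTop_mono (fun n => by
      simp only [Function.comp]; nlinarith [sq_nonneg (s n)])
      ((tendsto_pow_atTop (n := 4) (by norm_num)).comp h)

lemma ratio_tendsto (D u : ℕ → ℝ) (hD : Tendsto D atTop atTop) (hu : ∀ n, u n ^ 2 ≤ D n) :
    Tendsto (fun n => u n / D n) atTop (𝓝 0) := by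
  have h1 : Tendsto (fun n => (u n / D n) ^ 2) atTop (𝓝 0) := by
    refine tendsto_of_tendsto_of_tendsto_of_le_of_le' tendsto_const_nhds
      (tendsto_inv_atTop_zero.comp hD) (Eventually.of_forall fun n => sq_nonneg _) ?_
    filter_upwards [hD.eventually_gt_atTop 0] with n hn
    simp only [Function.comp]
    rw [div_pow, div_le_iff₀ (by positivity)]
    have : (D n)⁻¹ * D n ^ 2 = D n := by field_simp
    rw [this]; exact hu n
  have h2 := h1.sqrt
  simp only [Real.sqrt_sq_eq_abs, Real.sqrt_zero] at h2
  exact (tendsto_zero_iff_abs_tendsto_zero _).2 h2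

/-- Let `gₙ = 𝔰ₙ 𝔞ₙ` in `SL(2,ℝ)` with `sₙ → ∞` or `aₙ → ∞`. If
`gₙ K gₙ⁻¹ → H` in the Chabauty sense for a closed subgroup `H` of `SL(2,ℝ)`, then `H = Ñ⁺`. -/
theorem compact_conj_limit_Ntilde (s a : ℕ → ℝ) (ha : ∀ n, 0 < a n)
    (hdiv : Tendsto s atTop atTop ∨ Tendsto a atTop atTop)
    (H : Subgroup SL2) (hclosed : IsClosed (H : Set SL2))
    (hlim : ChabautyTendsto
      (fun n => conjSet (sMat (s n) * aMat (a n) (ha n).ne') KSL) (H : Set SL2)) :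
    (H : Set SL2) = NtildeSL := by
  have hD := D_tendsto s a hdiv
  have hDpos : ∀ n, 0 < a n ^ 4 + s n ^ 2 := fun n => by have := ha n; positivity
  have hsD := ratio_tendsto _ s hD (fun n => by have := ha n; nlinarith [pow_pos this 4])
  have haD := ratio_tendsto _ (fun n => a n ^ 2) hD
    (fun n => by nlinarith [sq_nonneg (s n)])
  have hiD := tendsto_inv_atTop_zero.comp hD
  obtain ⟨h1, h2⟩ := hlim
  apply Set.Subset.antisymm
  · intro h hh
    obtain ⟨u, hu, hul⟩ := h1 h hh
    rw [tendsto_SL2_iff] at hul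
    have e1 : ∀ n, (u n : M2) 1 0 = -((u n : M2) 0 1 * (a n ^ 4 + s n ^ 2)⁻¹) ∧
        (u n : M2) 1 1 = (u n : M2) 0 0 + 2 * ((u n : M2) 0 1 * (s n / (a n ^ 4 + s n ^ 2))) := by
      intro n
      obtain ⟨k, ⟨θ, hk⟩, hku⟩ := hu n
      have := conj_entries (s n) (a n) (ha n) k _ _ hk
      simp only at hku
      rw [hku] at this
      have hp := (hDpos n).ne'
      rw [this]
      simp
      constructor <;> field_simp
      ring
    have hc : (h : M2) 1 0 = 0 := by
      refine tendsto_nhds_unique (hul 1 0) ?_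
      have := ((hul 0 1).mul hiD).neg
      simp only [mul_zero, neg_zero] at this
      exact this.congr fun n => (e1 n).1.symm
    have hd : (h : M2) 1 1 = (h : M2) 0 0 := by
      refine tendsto_nhds_unique (hul 1 1) ?_
      have := (hul 0 0).add (((hul 0 1).mul hsD).const_mul 2)
      simp only [mul_zero, add_zero] at this
      exact this.congr fun n => (e1 n).2.symm
    have hdet := h.det_coe
    rw [Matrix.det_fin_two, hc, hd] at hdet
    have : ((h : M2) 0 0 - 1) * ((h : M2) 0 0 + 1) = 0 := by linarith
    rcases mul_eq_zero.1 this with h' | h'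
    · have h' : (h : M2) 0 0 = 1 := by linarith
      refine ⟨(h : M2) 0 1, Or.inl ?_⟩
      ext i j
      fin_cases i <;> fin_cases j <;> simp [hc, hd, h']
    · have h' : (h : M2) 0 0 = -1 := by linarith
      refine ⟨-(h : M2) 0 1, Or.inr ?_⟩
      ext i j
      fin_cases i <;> fin_cases j <;> simp [hc, hd, h']
  · have key : ∀ (θ₀ t : ℝ) (g : SL2), Real.sin θ₀ = 0 →
        (g : M2) = !![Real.cos θ₀, t; 0, Real.cos θ₀] → g ∈ (H : Set SL2) := by
      intro θ₀ t g hs hg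
      have hc2 : Real.cos θ₀ * Real.cos θ₀ = 1 := by
        have := Real.sin_sq_add_cos_sq θ₀
        rw [hs] at this; linarith
      set e := Real.cos θ₀ with he
      let σ : ℕ → ℝ := fun n => t * (a n ^ 2 / (a n ^ 4 + s n ^ 2))
      have hσ : Tendsto σ atTop (𝓝 0) := by simpa using haD.const_mul t
      have heσ : Tendsto (fun n => e * σ n) atTop (𝓝 0) := by simpa using hσ.const_mul e
      let θ : ℕ → ℝ := fun n => θ₀ + Real.arcsin (e * σ n)
      have hθ : Tendsto θ atTop (𝓝 θ₀) := by
        have := (Real.continuous_arcsin.tendsto 0).comp heσ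
        simpa using this.const_add θ₀
      have hcos : Tendsto (fun n => Real.cos (θ n)) atTop (𝓝 e) :=
        (Real.continuous_cos.tendsto _).comp hθ
      have hsin : ∀ᶠ n in atTop, Real.sin (θ n) = σ n := by
        filter_upwards [heσ.eventually (Icc_mem_nhds (a := (-1:ℝ)) (b := 1) (by norm_num)
          (by norm_num))] with n hn
        have h3 : Real.sin (θ n) = Real.sin (θ₀ + Real.arcsin (e * σ n)) := rfl
        rw [h3, Real.sin_add, hs, ← he, Real.sin_arcsin hn.1 hn.2]
        linear_combination σ n * hc2
      let k : ℕ → SL2 := fun n => ⟨!![Real.cos (θ n), Real.sin (θ n);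
        -Real.sin (θ n), Real.cos (θ n)], by
          rw [Matrix.det_fin_two_of]; nlinarith [Real.sin_sq_add_cos_sq (θ n)]⟩
      refine h2 id strictMono_id (fun n => sMat (s n) * aMat (a n) (ha n).ne' * k n *
        (sMat (s n) * aMat (a n) (ha n).ne')⁻¹) (fun n => ⟨k n, ⟨θ n, rfl⟩, rfl⟩) g ?_
      rw [tendsto_SL2_iff]
      have ee := fun n => conj_entries (s n) (a n) (ha n) (k n) _ _ rfl
      simp only [ee, hg]
      have q : ∀ᶠ n in atTop, Real.sin (θ n) / a n ^ 2 = t * (a n ^ 4 + s n ^ 2)⁻¹ := by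
        filter_upwards [hsin] with n hn
        rw [hn]
        have := (ha n).ne'
        have := (hDpos n).ne'
        simp only [σ]
        field_simp
      have q1 : Tendsto (fun n => Real.sin (θ n) / a n ^ 2) atTop (𝓝 0) := by
        have := hiD.const_mul t
        simp only [mul_zero] at this
        exact this.congr' (q.mono fun n hn => hn.symm)
      have q2 : Tendsto (fun n => s n * (Real.sin (θ n) / a n ^ 2)) atTop (𝓝 0) := by
        have := hsD.const_mul t
        simp only [mul_zero] at this
        refine this.congr' (q.mono fun n hn => ?_)
        simp only [hn]; ring
      have q3 : Tendsto (fun n => (a n ^ 4 + s n ^ 2) * (Real.sin (θ n) / a n ^ 2))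
          atTop (𝓝 t) := by
        refine tendsto_const_nhds.congr' (q.mono fun n hn => ?_)
        simp only [hn]
        have := (hDpos n).ne'
        field_simp
      intro i j
      fin_cases i <;> fin_cases j
      · simpa using hcos.sub q2
      · simpa using q3
      · simpa using q1.neg
      · simpa using hcos.add q2
    rintro g ⟨t, hg | hg⟩
    · exact key 0 t g (by simp) (by simpa using hg)
    · refine key Real.pi (-t) g (by simp) ?_
      rw [hg]
      ext i j
      fin_cases i <;> fin_cases j <;> simp
end
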